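/- arXiv:2407.00794 — 5 statements merged into one kernel-verified Lean document; each statement's English description precedes it below -/
import Mathlib

section
/- Let N ≥ 3 be a natural number and let p, q > 0 be real numbers. Let U, V : (0, ∞) → ℝ be twice continuously differentiable and positive, and suppose that for all r > 0: U''(r) + ((N-1)/r) U'(r) + V(r)^q = 0 and V''(r) + ((N-1)/r) V'(r) + U(r)^p = 0. Assume that r^N (U'(r)V(r) - U(r)V'(r)) → 0 as r → 0⁺ and as r → ∞, and that the functions r ↦ r^N U(r)^{p+1}, r ↦ r^N V(r)^{q+1}, r ↦ r^{N-1} |U'(r) V(r)| and r ↦ r^{N-1} |U(r) V'(r)| are Lebesgue integrable on (0, ∞). Then ∫₀^∞ r^N (U(r)^{p+1} - V(r)^{q+1}) dr = -∫₀^∞ r^{N-1} (U'(r)V(r) - U(r)V'(r)) dr. -/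
open MeasureTheory Set Filter

/-- A function that is continuous on `(0, ∞)` and has integrable weighted absolute value is
integrable against that weight. -/
theorem integrableOn_rpow_mul_of_abs {a : ℝ} {f : ℝ → ℝ} (hf : ContinuousOn f (Ioi 0))
    (h : IntegrableOn (fun r : ℝ => r ^ a * |f r|) (Ioi 0)) :
    IntegrableOn (fun r : ℝ => r ^ a * f r) (Ioi 0) := by
  have hc : ContinuousOn (fun r : ℝ => r ^ a * f r) (Ioi 0) :=
    (continuousOn_id.rpow_const fun r hr => Or.inl (ne_of_gt hr)).mul hf
  refine h.mono' (hc.aestronglyMeasurable measurableSet_Ioi) ?_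
  filter_upwards [ae_restrict_mem measurableSet_Ioi] with r (hr : 0 < r)
  rw [Real.norm_eq_abs, abs_mul, abs_of_pos (Real.rpow_pos_of_pos hr a)]

/-- Pohozaev-type identity for radial solutions of the Lane–Emden system:
`∫₀^∞ rᴺ (U^{p+1} - V^{q+1}) dr = -∫₀^∞ r^{N-1} (U'V - UV') dr`. -/
theorem stmt6 (N : ℕ) (hN : 3 ≤ N) (p q : ℝ) (hp : 0 < p) (hq : 0 < q)
    (U V U' V' U'' V'' : ℝ → ℝ)
    (hU' : ∀ r ∈ Ioi (0 : ℝ), HasDerivAt U (U' r) r)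
    (hU'' : ∀ r ∈ Ioi (0 : ℝ), HasDerivAt U' (U'' r) r)
    (hV' : ∀ r ∈ Ioi (0 : ℝ), HasDerivAt V (V' r) r)
    (hV'' : ∀ r ∈ Ioi (0 : ℝ), HasDerivAt V' (V'' r) r)
    (hUcont : ContinuousOn U'' (Ioi 0)) (hVcont : ContinuousOn V'' (Ioi 0))
    (hUpos : ∀ r ∈ Ioi (0 : ℝ), 0 < U r) (hVpos : ∀ r ∈ Ioi (0 : ℝ), 0 < V r)
    (hODE1 : ∀ r ∈ Ioi (0 : ℝ), U'' r + ((N : ℝ) - 1) / r * U' r + V r ^ q = 0)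
    (hODE2 : ∀ r ∈ Ioi (0 : ℝ), V'' r + ((N : ℝ) - 1) / r * V' r + U r ^ p = 0)
    (hlim0 : Tendsto (fun r : ℝ => r ^ (N : ℝ) * (U' r * V r - U r * V' r))
      (nhdsWithin 0 (Ioi 0)) (nhds 0))
    (hlimtop : Tendsto (fun r : ℝ => r ^ (N : ℝ) * (U' r * V r - U r * V' r))
      atTop (nhds 0))
    (hint1 : IntegrableOn (fun r : ℝ => r ^ (N : ℝ) * U r ^ (p + 1)) (Ioi 0))
    (hint2 : IntegrableOn (fun r : ℝ => r ^ (N : ℝ) * V r ^ (q + 1)) (Ioi 0))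
    (hint3 : IntegrableOn (fun r : ℝ => r ^ ((N : ℝ) - 1) * |U' r * V r|) (Ioi 0))
    (hint4 : IntegrableOn (fun r : ℝ => r ^ ((N : ℝ) - 1) * |U r * V' r|) (Ioi 0)) :
    ∫ r in Ioi (0 : ℝ), r ^ (N : ℝ) * (U r ^ (p + 1) - V r ^ (q + 1)) =
      -∫ r in Ioi (0 : ℝ), r ^ ((N : ℝ) - 1) * (U' r * V r - U r * V' r) := by
  have cU : ContinuousOn U (Ioi 0) := fun r hr => (hU' r hr).continuousAt.continuousWithinAt
  have cV : ContinuousOn V (Ioi 0) := fun r hr => (hV' r hr).continuousAt.continuousWithinAt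
  have cU' : ContinuousOn U' (Ioi 0) := fun r hr => (hU'' r hr).continuousAt.continuousWithinAt
  have cV' : ContinuousOn V' (Ioi 0) := fun r hr => (hV'' r hr).continuousAt.continuousWithinAt
  have intA : IntegrableOn
      (fun r : ℝ => r ^ (N : ℝ) * (U r ^ (p + 1) - V r ^ (q + 1))) (Ioi 0) := by
    simp only [mul_sub]
    exact hint1.sub hint2
  have intB : IntegrableOn
      (fun r : ℝ => r ^ ((N : ℝ) - 1) * (U' r * V r - U r * V' r)) (Ioi 0) := by
    simp only [mul_sub]
    exact (integrableOn_rpow_mul_of_abs (cU'.mul cV) hint3).sub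
      (integrableOn_rpow_mul_of_abs (cU.mul cV') hint4)
  have hpow : ∀ r ∈ Ioi (0 : ℝ), HasDerivAt (fun r : ℝ => r ^ (N : ℝ))
      ((N : ℝ) * r ^ ((N : ℝ) - 1)) r := fun r hr =>
    Real.hasDerivAt_rpow_const (Or.inl (ne_of_gt hr))
  have hW : ∀ r ∈ Ioi (0 : ℝ), HasDerivAt (fun r => U' r * V r - U r * V' r)
      (U'' r * V r - U r * V'' r) r := fun r hr =>
    (((hU'' r hr).mul (hV' r hr)).sub ((hU' r hr).mul (hV'' r hr))).congr_deriv (by ring)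
  have key : ∀ r ∈ Ioi (0 : ℝ),
      r ^ (N : ℝ) * (U r ^ (p + 1) - V r ^ (q + 1)) +
        r ^ ((N : ℝ) - 1) * (U' r * V r - U r * V' r) =
      (N : ℝ) * r ^ ((N : ℝ) - 1) * (U' r * V r - U r * V' r) +
        r ^ (N : ℝ) * (U'' r * V r - U r * V'' r) := by
    intro r hr
    have hr0 : r ≠ 0 := ne_of_gt hr
    have h1 : U'' r = -(((N : ℝ) - 1) / r * U' r) - V r ^ q := by linarith [hODE1 r hr]
    have h2 : V'' r = -(((N : ℝ) - 1) / r * V' r) - U r ^ p := by linarith [hODE2 r hr]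
    rw [h1, h2, Real.rpow_add_one (hUpos r hr).ne', Real.rpow_add_one (hVpos r hr).ne',
      Real.rpow_sub_one hr0]
    field_simp
    ring
  have hzero := integral_Ioi_deriv_mul_eq_sub hpow hW
    ((intA.add intB).congr_fun key measurableSet_Ioi) hlim0 hlimtop
  rw [← setIntegral_congr_fun measurableSet_Ioi key, integral_add intA intB] at hzero
  linarith
end

section
/- Let N ≥ 4 be a natural number and let γ be a real number with 0 < γ < 1. Then there exists a constant C > 0 such that for every R ≥ 1 and every x ∈ ℝ^{N-1}, ∫_{{y ∈ ℝ^{N-1} : |y| ≤ R}} |x - y|^{-(N-2)} (1+|y|)^{-γ} dy ≤ C R^{1-γ}. -/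
open MeasureTheory

/-- The power `r ^ (-s)` cut off at radius `R`. -/
noncomputable def truncatedPower (R s : ℝ) : ℝ → ℝ :=
  (Set.Iic R).indicator fun r => r ^ (-s)

lemma truncatedPower_of_le {R s r : ℝ} (h : r ≤ R) : truncatedPower R s r = r ^ (-s) :=
  Set.indicator_of_mem (Set.mem_Iic.2 h) _

lemma truncatedPower_nonneg (R s : ℝ) {r : ℝ} (hr : 0 ≤ r) : 0 ≤ truncatedPower R s r :=
  Set.indicator_apply_nonneg fun _ => Real.rpow_nonneg hr _

lemma pow_smul_truncatedPower_eqOn (n : ℕ) (R γ : ℝ) :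
    Set.EqOn (fun r : ℝ => r ^ n • truncatedPower R (n + γ) r)
      ((Set.Iic R).indicator fun r => r ^ (-γ)) (Set.Ioi 0) := by
  intro r (hr : 0 < r)
  by_cases h : r ≤ R
  · simp only [truncatedPower, Set.indicator_of_mem (Set.mem_Iic.2 h), smul_eq_mul]
    rw [← Real.rpow_natCast, ← Real.rpow_add hr]
    congr 1
    ring
  · simp [truncatedPower, h]

section Radial

variable {E : Type*} [NormedAddCommGroup E] [NormedSpace ℝ E] [FiniteDimensional ℝ E]
  [Nontrivial E] [MeasurableSpace E] [BorelSpace E] (μ : Measure E) [μ.IsAddHaarMeasure]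

lemma integrable_truncatedPower_norm {R γ : ℝ} (hR : 0 ≤ R) (hγ : γ < 1) :
    Integrable (fun z : E =>
      truncatedPower R (((Module.finrank ℝ E - 1 : ℕ) : ℝ) + γ) ‖z‖) μ := by
  rw [integrable_fun_norm_addHaar μ,
    integrableOn_congr_fun (pow_smul_truncatedPower_eqOn _ R γ) measurableSet_Ioi,
    IntegrableOn, integrable_indicator_iff measurableSet_Iic, IntegrableOn,
    Measure.restrict_restrict measurableSet_Iic, Set.inter_comm, Set.Ioi_inter_Iic]
  exact (intervalIntegrable_iff_integrableOn_Ioc_of_le hR).1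
    (intervalIntegral.intervalIntegrable_rpow' (by linarith))

lemma integral_truncatedPower_norm {R γ : ℝ} (hR : 0 ≤ R) (hγ : γ < 1) :
    ∫ z : E, truncatedPower R (((Module.finrank ℝ E - 1 : ℕ) : ℝ) + γ) ‖z‖ ∂μ =
      Module.finrank ℝ E * μ.real (Metric.ball 0 1) / (1 - γ) * R ^ (1 - γ) := by
  rw [integral_fun_norm_addHaar μ,
    setIntegral_congr_fun measurableSet_Ioi (pow_smul_truncatedPower_eqOn _ R γ),
    setIntegral_indicator measurableSet_Iic, Set.Ioi_inter_Iic,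
    ← intervalIntegral.integral_of_le hR, integral_rpow (Or.inl (by linarith)),
    show -γ + 1 = 1 - γ by ring, Real.zero_rpow (by linarith), nsmul_eq_mul, smul_eq_mul]
  ring

end Radial

lemma rpow_mul_one_add_rpow_le {R n γ a b : ℝ} (hn : 0 < n) (hγ : 0 ≤ γ) (ha : 0 ≤ a)
    (hb : 0 < b) (hbR : b ≤ R) :
    a ^ (-n) * (1 + b) ^ (-γ) ≤ truncatedPower R (n + γ) a + truncatedPower R (n + γ) b := by
  have hA := truncatedPower_nonneg R (n + γ) ha
  have hB := truncatedPower_nonneg R (n + γ) hb.le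
  rcases ha.eq_or_lt with rfl | ha
  · rw [Real.zero_rpow (neg_ne_zero.2 hn.ne'), zero_mul]
    exact add_nonneg hA hB
  rcases le_total a b with hab | hab
  · calc a ^ (-n) * (1 + b) ^ (-γ) ≤ a ^ (-n) * a ^ (-γ) :=
          mul_le_mul_of_nonneg_left
            (Real.rpow_le_rpow_of_nonpos ha (by linarith) (by linarith)) (by positivity)
      _ = truncatedPower R (n + γ) a := by
          rw [truncatedPower_of_le (hab.trans hbR), ← Real.rpow_add ha, neg_add]
      _ ≤ _ := le_add_of_nonneg_right hB
  · calc a ^ (-n) * (1 + b) ^ (-γ) ≤ b ^ (-n) * b ^ (-γ) :=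
          mul_le_mul (Real.rpow_le_rpow_of_nonpos hb hab (by linarith))
            (Real.rpow_le_rpow_of_nonpos hb (by linarith) (by linarith))
            (by positivity) (by positivity)
      _ = truncatedPower R (n + γ) b := by
          rw [truncatedPower_of_le hbR, ← Real.rpow_add hb, neg_add]
      _ ≤ _ := le_add_of_nonneg_left hA

/-- boundary Riesz-potential estimate, regime `0 < γ < 1`:
`∫_{|y| ≤ R} |x-y|^{-(N-2)} (1+|y|)^{-γ} dy ≤ C R^{1-γ}` on `ℝ^{N-1}`. -/
theorem stmt9 (N : ℕ) (hN : 4 ≤ N) (γ : ℝ) (hγ0 : 0 < γ) (hγ1 : γ < 1) :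
    ∃ C > 0, ∀ R : ℝ, 1 ≤ R → ∀ x : EuclideanSpace ℝ (Fin (N - 1)),
      ∫ y in {y : EuclideanSpace ℝ (Fin (N - 1)) | ‖y‖ ≤ R},
          ‖x - y‖ ^ (-((N : ℝ) - 2)) * (1 + ‖y‖) ^ (-γ) ≤
        C * R ^ (1 - γ) := by
  set E := EuclideanSpace ℝ (Fin (N - 1))
  have hdim : Module.finrank ℝ E = N - 1 := finrank_euclideanSpace_fin
  have : Nontrivial E := Module.nontrivial_of_finrank_pos (R := ℝ) (by omega)
  have hN' : (4 : ℝ) ≤ N := by exact_mod_cast hN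
  have hexp : ((Module.finrank ℝ E - 1 : ℕ) : ℝ) = (N : ℝ) - 2 := by
    rw [hdim, Nat.sub_sub, Nat.cast_sub (by omega)]
    norm_num
  set c : ℝ := Module.finrank ℝ E * volume.real (Metric.ball (0 : E) 1) / (1 - γ)
  have hc : 0 < c := by
    have hball : 0 < volume.real (Metric.ball (0 : E) 1) :=
      ENNReal.toReal_pos (Metric.measure_ball_pos _ _ one_pos).ne' measure_ball_lt_top.ne
    exact div_pos (mul_pos (Nat.cast_pos.2 Module.finrank_pos) hball) (by linarith)
  refine ⟨2 * c, by positivity, fun R hR x => ?_⟩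
  have hR0 : 0 ≤ R := by linarith
  set k : E → ℝ := fun z => truncatedPower R ((N : ℝ) - 2 + γ) ‖z‖
  have hk : Integrable k := by
    simpa only [hexp] using integrable_truncatedPower_norm (volume : Measure E) hR0 hγ1
  have hk_int : ∫ z, k z = c * R ^ (1 - γ) := by
    simpa only [hexp] using integral_truncatedPower_norm (volume : Measure E) hR0 hγ1
  have hk_sum : Integrable fun y => k (x - y) + k y := (hk.comp_sub_left x).add hk
  have hk_nonneg (z : E) : 0 ≤ k z := truncatedPower_nonneg _ _ (norm_nonneg z)
  have hmeas : MeasurableSet {y : E | ‖y‖ ≤ R} := measurableSet_le measurable_norm measurable_const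
  calc ∫ y in {y : E | ‖y‖ ≤ R}, ‖x - y‖ ^ (-((N : ℝ) - 2)) * (1 + ‖y‖) ^ (-γ)
      ≤ ∫ y in {y : E | ‖y‖ ≤ R}, (k (x - y) + k y) := by
        refine integral_mono_of_nonneg (.of_forall fun y => by positivity)
          hk_sum.integrableOn ?_
        filter_upwards [ae_restrict_mem hmeas,
          ae_restrict_of_ae (Measure.ae_ne volume (0 : E))] with y hyR hy
        exact rpow_mul_one_add_rpow_le (by linarith) hγ0.le (norm_nonneg _)
          (norm_pos_iff.2 hy) hyR
    _ ≤ ∫ y, (k (x - y) + k y) :=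
        setIntegral_le_integral hk_sum
          (.of_forall fun y => add_nonneg (hk_nonneg _) (hk_nonneg _))
    _ = 2 * c * R ^ (1 - γ) := by
        rw [integral_add (hk.comp_sub_left x) hk, integral_sub_left_eq_self k volume x, hk_int]
        ring
end

section
/- Let N ≥ 4 be a natural number and let γ be a real number with 0 < γ < 1. Then there exists a constant C > 0 such that for every x ∈ ℝ^{N-1} and every R ≥ 1, setting d := |x|/2, one has ∫_{{y ∈ ℝ^{N-1} : |y| ≤ R, |y| ≥ d, |y - x| ≥ d}} |x - y|^{-(N-2)} (1+|y|)^{-γ} dy ≤ C R^{1-γ}. -/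
open MeasureTheory

/-- On a nontrivial finite-dimensional space, `‖y‖ ^ (1 - dim E - γ)` is integrable on the closed
ball of radius `R`, and its integral there is a constant multiple of `R ^ (1 - γ)`. -/
theorem integral_indicator_norm_rpow {E : Type*} [NormedAddCommGroup E] [NormedSpace ℝ E]
    [Nontrivial E] [FiniteDimensional ℝ E] [MeasurableSpace E] [BorelSpace E]
    (μ : Measure E) [μ.IsAddHaarMeasure] {γ : ℝ} (hγ : γ < 1) {R : ℝ} (hR : 0 ≤ R) :
    Integrable (fun y : E ↦ (Set.Iic R).indicator
        (fun r : ℝ ↦ r ^ (1 - (Module.finrank ℝ E : ℝ) - γ)) ‖y‖) μ ∧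
      ∫ y : E, (Set.Iic R).indicator
        (fun r : ℝ ↦ r ^ (1 - (Module.finrank ℝ E : ℝ) - γ)) ‖y‖ ∂μ =
        Module.finrank ℝ E * μ.real (Metric.ball 0 1) / (1 - γ) * R ^ (1 - γ) := by
  have hpos : 0 < Module.finrank ℝ E := Module.finrank_pos
  have key : Set.EqOn (fun r : ℝ ↦ r ^ (Module.finrank ℝ E - 1) • (Set.Iic R).indicator
      (fun r : ℝ ↦ r ^ (1 - (Module.finrank ℝ E : ℝ) - γ)) r)
      ((Set.Iic R).indicator fun r : ℝ ↦ r ^ (-γ)) (Set.Ioi 0) := by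
    intro r (hr : 0 < r)
    by_cases h : r ∈ Set.Iic R
    · simp only [Set.indicator_of_mem h, smul_eq_mul]
      rw [← Real.rpow_natCast, ← Real.rpow_add hr, Nat.cast_sub hpos]
      congr 1
      push_cast
      ring
    · simp [Set.indicator_of_notMem h]
  have hint : IntervalIntegrable (fun r : ℝ ↦ r ^ (-γ)) volume 0 R :=
    intervalIntegral.intervalIntegrable_rpow' (by linarith)
  constructor
  · rw [integrable_fun_norm_addHaar μ, integrableOn_congr_fun key measurableSet_Ioi,
      IntegrableOn, integrable_indicator_iff measurableSet_Iic, IntegrableOn,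
      Measure.restrict_restrict measurableSet_Iic, Set.Iic_inter_Ioi]
    exact (intervalIntegrable_iff_integrableOn_Ioc_of_le hR).1 hint
  · rw [integral_fun_norm_addHaar μ, setIntegral_congr_fun measurableSet_Ioi key,
      integral_indicator measurableSet_Iic, Measure.restrict_restrict measurableSet_Iic,
      Set.Iic_inter_Ioi, ← intervalIntegral.integral_of_le hR,
      integral_rpow (Or.inl (by linarith)), Real.zero_rpow (by linarith), sub_zero,
      neg_add_eq_sub]
    simp only [nsmul_eq_mul, smul_eq_mul]
    ring

/-- If `‖y‖` is at most three times `‖x - y‖`, then `‖x - y‖ ^ (-a) * (1 + ‖y‖) ^ (-γ)` is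
controlled by a power of `‖y‖`. -/
theorem rpow_norm_sub_mul_rpow_le {E : Type*} [NormedAddCommGroup E] {x y : E} {a γ : ℝ}
    (ha : 0 < a) (hγ : 0 ≤ γ) (hx : ‖x‖ / 2 ≤ ‖y‖) (hxy : ‖x‖ / 2 ≤ ‖y - x‖) :
    ‖x - y‖ ^ (-a) * (1 + ‖y‖) ^ (-γ) ≤ 3 ^ a * ‖y‖ ^ (-a - γ) := by
  rcases eq_or_ne y 0 with rfl | hy
  · have hx0 : x = 0 := by
      rw [norm_zero] at hx
      exact norm_le_zero_iff.1 (by linarith)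
    simp only [hx0, sub_zero, norm_zero, Real.zero_rpow (neg_ne_zero.2 ha.ne'), zero_mul]
    positivity
  · have hy0 : 0 < ‖y‖ := norm_pos_iff.2 hy
    have h3 : ‖y‖ / 3 ≤ ‖x - y‖ := by
      have := norm_le_norm_add_norm_sub' y x
      rw [norm_sub_rev x y]
      linarith
    calc ‖x - y‖ ^ (-a) * (1 + ‖y‖) ^ (-γ)
        ≤ (‖y‖ / 3) ^ (-a) * ‖y‖ ^ (-γ) := by
          refine mul_le_mul ?_ ?_ (by positivity) (by positivity)
          · exact Real.rpow_le_rpow_of_nonpos (by positivity) h3 (by linarith)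
          · exact Real.rpow_le_rpow_of_nonpos hy0 (by linarith) (by linarith)
      _ = 3 ^ a * ‖y‖ ^ (-a - γ) := by
          rw [Real.div_rpow hy0.le (by norm_num), Real.rpow_neg (by norm_num : (0 : ℝ) ≤ 3),
            sub_eq_add_neg, Real.rpow_add hy0, div_inv_eq_mul]
          ring

/-- intermediate-region piece of the boundary Riesz-potential estimate,
regime `0 < γ < 1`: with `d := |x|/2`,
`∫_{|y| ≤ R, |y| ≥ d, |y-x| ≥ d} |x-y|^{-(N-2)} (1+|y|)^{-γ} dy ≤ C R^{1-γ}` on `ℝ^{N-1}`. -/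
theorem stmt11 (N : ℕ) (hN : 4 ≤ N) (γ : ℝ) (hγ0 : 0 < γ) (hγ1 : γ < 1) :
    ∃ C > 0, ∀ x : EuclideanSpace ℝ (Fin (N - 1)), ∀ R : ℝ, 1 ≤ R →
      ∫ y in {y : EuclideanSpace ℝ (Fin (N - 1)) |
            ‖y‖ ≤ R ∧ ‖x‖ / 2 ≤ ‖y‖ ∧ ‖x‖ / 2 ≤ ‖y - x‖},
          ‖x - y‖ ^ (-((N : ℝ) - 2)) * (1 + ‖y‖) ^ (-γ) ≤
        C * R ^ (1 - γ) := by
  have hN4 : (4 : ℝ) ≤ N := by exact_mod_cast hN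
  have : Nonempty (Fin (N - 1)) := ⟨⟨0, by omega⟩⟩
  have hdim : (Module.finrank ℝ (EuclideanSpace ℝ (Fin (N - 1))) : ℝ) = N - 1 := by
    rw [finrank_euclideanSpace_fin, Nat.cast_sub (by omega), Nat.cast_one]
  have hball : 0 < (volume : Measure (EuclideanSpace ℝ (Fin (N - 1)))).real (Metric.ball 0 1) :=
    ENNReal.toReal_pos (Metric.measure_ball_pos _ _ one_pos).ne' measure_ball_lt_top.ne
  refine ⟨3 ^ ((N : ℝ) - 2) * (((N : ℝ) - 1) *
    (volume : Measure (EuclideanSpace ℝ (Fin (N - 1)))).real (Metric.ball 0 1) / (1 - γ)),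
    ?_, fun x R hR ↦ ?_⟩
  · have h1 : 0 < (N : ℝ) - 1 := by linarith
    have h2 : 0 < 1 - γ := by linarith
    positivity
  obtain ⟨hint, heq⟩ := integral_indicator_norm_rpow
    (volume : Measure (EuclideanSpace ℝ (Fin (N - 1)))) hγ1 (zero_le_one.trans hR)
  rw [hdim] at hint heq
  have hmeas : MeasurableSet {y : EuclideanSpace ℝ (Fin (N - 1)) |
      ‖y‖ ≤ R ∧ ‖x‖ / 2 ≤ ‖y‖ ∧ ‖x‖ / 2 ≤ ‖y - x‖} := by
    simp only [Set.ofPred_and]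
    refine IsClosed.measurableSet ((isClosed_le ?_ ?_).inter
      ((isClosed_le ?_ ?_).inter (isClosed_le ?_ ?_))) <;> fun_prop
  rw [mul_assoc, ← heq, ← integral_const_mul, ← integral_indicator hmeas]
  refine integral_mono_of_nonneg (.of_forall fun y ↦ ?_) (hint.const_mul _)
    (.of_forall fun y ↦ ?_)
  · exact Set.indicator_nonneg (fun y _ ↦ by positivity) y
  · refine Set.indicator_apply_le' (fun hy ↦ ?_) (fun _ ↦ ?_)
    · obtain ⟨hyR, hxy, hxy'⟩ := hy
      beta_reduce
      rw [Set.indicator_of_mem (Set.mem_Iic.2 hyR),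
        show 1 - ((N : ℝ) - 1) - γ = -((N : ℝ) - 2) - γ by ring]
      exact rpow_norm_sub_mul_rpow_le (by linarith) hγ0.le hxy hxy'
    · exact mul_nonneg (by positivity) (Set.indicator_apply_nonneg fun _ ↦ by positivity)
end

section
/- Let N ≥ 3 be a natural number, let γ > 0 and let 0 < c₂ < c₁ be real numbers. Then there exists a constant C > 0 such that for every real t ≥ 1 and every x ∈ ℝ^N, ∫_{{y ∈ ℝ^N : c₂ t ≤ |y| ≤ c₁ t}} |x - y|^{-(N-2)} (1+|y|)^{-(γ+2)} dy ≤ C t^{-γ}. -/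
open MeasureTheory

open scoped Pointwise in
/-- The integral of `‖z‖ ^ (-a)` over the ball of radius `t` scales like `t ^ (d - a)`. -/
lemma setIntegral_ball_norm_rpow_neg {E : Type*} [NormedAddCommGroup E] [NormedSpace ℝ E]
    [FiniteDimensional ℝ E] [MeasurableSpace E] [BorelSpace E] (μ : Measure E)
    [μ.IsAddHaarMeasure] (a : ℝ) {t : ℝ} (ht : 0 < t) :
    ∫ z in Metric.ball (0 : E) t, ‖z‖ ^ (-a) ∂μ =
      t ^ ((Module.finrank ℝ E : ℝ) - a) * ∫ z in Metric.ball (0 : E) 1, ‖z‖ ^ (-a) ∂μ := by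
  have h := Measure.setIntegral_comp_smul_of_pos μ (fun z : E => ‖z‖ ^ (-a))
    (Metric.ball (0 : E) 1) ht
  have hball : t • Metric.ball (0 : E) 1 = Metric.ball (0 : E) t := by
    rw [smul_ball ht.ne', smul_zero, Real.norm_of_nonneg ht.le, mul_one]
  have hscale : ∀ z : E, ‖t • z‖ ^ (-a) = t ^ (-a) * ‖z‖ ^ (-a) := fun z => by
    rw [norm_smul, Real.norm_of_nonneg ht.le, Real.mul_rpow ht.le (norm_nonneg z)]
  simp only [hscale, hball, integral_const_mul, smul_eq_mul] at h
  rw [sub_eq_add_neg, Real.rpow_add ht, Real.rpow_natCast, mul_assoc, h,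
    mul_inv_cancel_left₀ (pow_pos ht _).ne']

/-- annular Riesz-potential estimate:
`∫_{c₂ t ≤ |y| ≤ c₁ t} |x-y|^{-(N-2)} (1+|y|)^{-(γ+2)} dy ≤ C t^{-γ}` on `ℝ^N`. -/
theorem stmt13 (N : ℕ) (hN : 3 ≤ N) (γ : ℝ) (hγ : 0 < γ) (c₁ c₂ : ℝ)
    (hc₂ : 0 < c₂) (hc : c₂ < c₁) :
    ∃ C > 0, ∀ t : ℝ, 1 ≤ t → ∀ x : EuclideanSpace ℝ (Fin N),
      ∫ y in {y : EuclideanSpace ℝ (Fin N) | c₂ * t ≤ ‖y‖ ∧ ‖y‖ ≤ c₁ * t},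
          ‖x - y‖ ^ (-((N : ℝ) - 2)) * (1 + ‖y‖) ^ (-(γ + 2)) ≤
        C * t ^ (-γ) := by
  have : Nonempty (Fin N) := ⟨⟨0, by omega⟩⟩
  have hN' : (3 : ℝ) ≤ N := by exact_mod_cast hN
  have hc₁ : 0 < c₁ := hc₂.trans hc
  set E := EuclideanSpace ℝ (Fin N)
  have hdim : Module.finrank ℝ E = N := finrank_euclideanSpace_fin
  set I : ℝ := ∫ z in Metric.ball (0 : E) 1, ‖z‖ ^ (-((N : ℝ) - 2))
  have hI0 : 0 ≤ I := integral_nonneg fun z => by positivity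
  set V : ℝ := volume.real (Metric.ball (0 : E) 1)
  have hV0 : 0 < V := ENNReal.toReal_pos
    (Metric.measure_ball_pos volume _ one_pos).ne' measure_ball_lt_top.ne
  refine ⟨c₂ ^ (-(γ + 2)) * (c₁ ^ N * V + I), by positivity, fun t ht x => ?_⟩
  have ht0 : 0 < t := one_pos.trans_le ht
  set S : Set E := {y | c₂ * t ≤ ‖y‖ ∧ ‖y‖ ≤ c₁ * t}
  have hSsub : S ⊆ Metric.closedBall 0 (c₁ * t) := fun y hy => by simpa using hy.2
  have hSmeas : MeasurableSet S :=
    ((isClosed_le continuous_const continuous_norm).inter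
      (isClosed_le continuous_norm continuous_const)).measurableSet
  have hSfin : volume S ≠ ⊤ :=
    ((measure_mono hSsub).trans_lt measure_closedBall_lt_top).ne
  have hSvol : volume.real S ≤ (c₁ * t) ^ N * V := by
    calc volume.real S ≤ volume.real (Metric.closedBall (0 : E) (c₁ * t)) :=
          measureReal_mono hSsub measure_closedBall_lt_top.ne
      _ = _ := by
          rw [Measure.addHaar_real_closedBall _ _ (by positivity), hdim]
  set h : E → ℝ := (Metric.ball (0 : E) t).indicator fun z => ‖z‖ ^ (-((N : ℝ) - 2)) with hh
  have hh0 : ∀ z, 0 ≤ h z := fun z => Set.indicator_nonneg (fun _ _ => by positivity) z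
  have hint : Integrable h := by
    rw [hh, integrable_indicator_iff measurableSet_ball]
    refine integrableOn_ball_of_norm_le_rpow (C := 1) (α := (N : ℝ) - 2) (by omega)
      (by rw [hdim]; linarith) (.of_forall fun z => ?_)
      (measurable_norm.pow_const _).aestronglyMeasurable
    rw [one_mul, Real.norm_of_nonneg (by positivity)]
  have hint' : Integrable fun y => h (x - y) := hint.comp_sub_left x
  have hhI : ∫ y in S, h (x - y) ≤ t ^ (2 : ℝ) * I := by
    calc ∫ y in S, h (x - y) ≤ ∫ y, h (x - y) :=
          setIntegral_le_integral hint' (.of_forall fun y => hh0 _)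
      _ = ∫ z, h z := integral_sub_left_eq_self h volume x
      _ = _ := by
          rw [hh, integral_indicator measurableSet_ball, setIntegral_ball_norm_rpow_neg _ _ ht0,
            hdim, sub_sub_cancel]
  have hconst : IntegrableOn (fun _ : E => t ^ (-((N : ℝ) - 2))) S := integrableOn_const hSfin
  have hintS : IntegrableOn (fun y => t ^ (-((N : ℝ) - 2)) + h (x - y)) S :=
    hconst.add hint'.integrableOn
  have hpt : ∀ y ∈ S, ‖x - y‖ ^ (-((N : ℝ) - 2)) * (1 + ‖y‖) ^ (-(γ + 2)) ≤
      (c₂ * t) ^ (-(γ + 2)) * (t ^ (-((N : ℝ) - 2)) + h (x - y)) := by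
    intro y hy
    have hweight : (1 + ‖y‖) ^ (-(γ + 2)) ≤ (c₂ * t) ^ (-(γ + 2)) :=
      Real.rpow_le_rpow_of_nonpos (by positivity) (by linarith [hy.1]) (by linarith)
    have hkernel : ‖x - y‖ ^ (-((N : ℝ) - 2)) ≤ t ^ (-((N : ℝ) - 2)) + h (x - y) := by
      by_cases hxy : x - y ∈ Metric.ball (0 : E) t
      · rw [hh, Set.indicator_of_mem hxy]
        exact le_add_of_nonneg_left (by positivity)
      · have hle : t ≤ ‖x - y‖ := by simpa using hxy
        exact (Real.rpow_le_rpow_of_nonpos ht0 hle (by linarith)).trans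
          (le_add_of_nonneg_right (hh0 _))
    rw [mul_comm]
    gcongr
  have ht2 : t ^ (-((N : ℝ) - 2)) * t ^ N = t ^ (2 : ℝ) := by
    rw [← Real.rpow_natCast t N, ← Real.rpow_add ht0]
    ring_nf
  have htγ : t ^ (-(γ + 2)) * t ^ (2 : ℝ) = t ^ (-γ) := by
    rw [← Real.rpow_add ht0]
    ring_nf
  calc _ ≤ ∫ y in S, (c₂ * t) ^ (-(γ + 2)) * (t ^ (-((N : ℝ) - 2)) + h (x - y)) :=
        integral_mono_of_nonneg (.of_forall fun y => by positivity) (hintS.const_mul _)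
          ((ae_restrict_iff' hSmeas).2 (.of_forall hpt))
    _ = (c₂ * t) ^ (-(γ + 2)) *
        (t ^ (-((N : ℝ) - 2)) * volume.real S + ∫ y in S, h (x - y)) := by
        rw [integral_const_mul, integral_add hconst hint'.integrableOn,
          setIntegral_const, smul_eq_mul, mul_comm (volume.real S)]
    _ ≤ (c₂ * t) ^ (-(γ + 2)) *
        (t ^ (-((N : ℝ) - 2)) * ((c₁ * t) ^ N * V) + t ^ (2 : ℝ) * I) := by
        gcongr
    _ = c₂ ^ (-(γ + 2)) * (c₁ ^ N * V + I) * t ^ (-γ) := by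
        rw [Real.mul_rpow hc₂.le ht0.le, mul_pow, ← htγ, ← ht2]
        ring
end

section
/- Let N ≥ 3 be a natural number and let γ be a real number with 2 < γ < N. Then there exists a constant C > 0 such that for every x ∈ ℝ^N, ∫_{ℝ^N} |x - y|^{-(N-2)} (1+|y|)^{-γ} dy ≤ C (1+|x|)^{2-γ}. -/
open MeasureTheory

section RieszPotential

open Metric Module

/-- The singularity `‖y‖ ^ (-s)` is integrable on the unit ball when `s` is less than the
dimension. -/
lemma integrableOn_ball_norm_rpow_neg {E : Type*} [NormedAddCommGroup E] [NormedSpace ℝ E]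
    [MeasurableSpace E] [BorelSpace E] [FiniteDimensional ℝ E] [Nontrivial E]
    (μ : Measure E) [μ.IsAddHaarMeasure] {s : ℝ} (hs : s < finrank ℝ E) :
    IntegrableOn (fun y : E => ‖y‖ ^ (-s)) (ball 0 1) μ := by
  rw [integrableOn_fun_norm_addHaar μ (f := fun t : ℝ => t ^ (-s))]
  have hpos : 1 ≤ finrank ℝ E := finrank_pos
  have h : IntegrableOn (fun t : ℝ => t ^ ((finrank ℝ E : ℝ) - 1 - s)) (Set.Ioo 0 1) :=
    (intervalIntegral.integrableOn_Ioo_rpow_iff one_pos).2 (by linarith)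
  refine h.congr_fun (fun t ht => ?_) measurableSet_Ioo
  have ht0 : 0 < t := ht.1
  simp only [smul_eq_mul]
  rw [← Real.rpow_natCast, ← Real.rpow_add ht0]
  push_cast [Nat.cast_sub hpos]
  ring_nf

/-- A function with a singularity of order `γ < dim E` at the origin and decay of order
`γ + s > dim E` at infinity is integrable. -/
lemma integrable_norm_rpow_neg_mul_one_add_norm_rpow_neg {E : Type*} [NormedAddCommGroup E]
    [NormedSpace ℝ E] [MeasurableSpace E] [BorelSpace E] [FiniteDimensional ℝ E] [Nontrivial E]
    (μ : Measure E) [μ.IsAddHaarMeasure] {γ s : ℝ} (hγ0 : 0 ≤ γ)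
    (hγ : γ < finrank ℝ E) (hγs : finrank ℝ E < γ + s) :
    Integrable (fun y : E => ‖y‖ ^ (-γ) * (1 + ‖y‖) ^ (-s)) μ := by
  have h₁ := (integrable_indicator_iff measurableSet_ball).2
    (integrableOn_ball_norm_rpow_neg μ hγ)
  have h₂ := (integrable_one_add_norm (μ := μ) hγs).const_mul ((2 : ℝ) ^ γ)
  refine (h₁.add h₂).mono' (Measurable.aestronglyMeasurable (by fun_prop))
    (Filter.Eventually.of_forall fun y => ?_)
  rw [Real.norm_of_nonneg (by positivity), Pi.add_apply]
  by_cases hy : y ∈ ball (0 : E) 1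
  · rw [Set.indicator_of_mem hy]
    have h : (1 + ‖y‖) ^ (-s) ≤ 1 :=
      Real.rpow_le_one_of_one_le_of_nonpos (by linarith [norm_nonneg y]) (by linarith)
    have h' : 0 ≤ (2 : ℝ) ^ γ * (1 + ‖y‖) ^ (-(γ + s)) := by positivity
    have := mul_le_of_le_one_right (Real.rpow_nonneg (norm_nonneg y) (-γ)) h
    linarith
  · rw [Set.indicator_of_notMem hy, zero_add]
    have hy1 : 1 ≤ ‖y‖ := by simpa using hy
    have h : ‖y‖ ^ (-γ) ≤ ((1 + ‖y‖) / 2) ^ (-γ) :=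
      Real.rpow_le_rpow_of_nonpos (by positivity) (by linarith) (by linarith)
    rw [Real.div_rpow (by positivity) (by norm_num), Real.rpow_neg (by norm_num : (0 : ℝ) ≤ 2),
      div_inv_eq_mul] at h
    rw [neg_add, Real.rpow_add (by positivity)]
    calc ‖y‖ ^ (-γ) * (1 + ‖y‖) ^ (-s)
        ≤ ((1 + ‖y‖) ^ (-γ) * 2 ^ γ) * (1 + ‖y‖) ^ (-s) := by gcongr
      _ = _ := by ring

/-- Pointwise bound near the pole of the Riesz kernel. -/
lemma rpow_neg_mul_one_add_rpow_neg_le_of_lt {a b R s γ : ℝ} (ha : 0 ≤ a) (hR : 0 < R)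
    (hγ : 0 ≤ γ) (hRab : R ≤ a + (1 + b)) (haR : a < R / 2) :
    a ^ (-s) * (1 + b) ^ (-γ) ≤ R ^ (-s) * R ^ (-γ) * (2 ^ γ * (R⁻¹ * a) ^ (-s)) := by
  have h : (1 + b) ^ (-γ) ≤ (R / 2) ^ (-γ) :=
    Real.rpow_le_rpow_of_nonpos (by positivity) (by linarith) (by linarith)
  rw [Real.div_rpow hR.le (by norm_num), Real.rpow_neg (by norm_num : (0 : ℝ) ≤ 2),
    div_inv_eq_mul] at h
  have h' : a ^ (-s) = R ^ (-s) * (R⁻¹ * a) ^ (-s) := by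
    rw [← Real.mul_rpow hR.le (by positivity), mul_inv_cancel_left₀ hR.ne']
  calc a ^ (-s) * (1 + b) ^ (-γ) ≤ a ^ (-s) * (R ^ (-γ) * 2 ^ γ) := by gcongr
    _ = _ := by rw [h']; ring

/-- Pointwise bound away from the pole of the Riesz kernel. -/
lemma rpow_neg_mul_one_add_rpow_neg_le_of_le {a b R s γ : ℝ} (hb : 0 < b) (hR : 0 < R)
    (hs : 0 ≤ s) (hγ : 0 ≤ γ) (hba : b ≤ a + R) (haR : R / 2 ≤ a) :
    a ^ (-s) * (1 + b) ^ (-γ) ≤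
      R ^ (-s) * R ^ (-γ) * (5 ^ s * ((R⁻¹ * b) ^ (-γ) * (1 + R⁻¹ * b) ^ (-s))) := by
  have h₁ : a ^ (-s) ≤ ((R * (1 + R⁻¹ * b)) / 5) ^ (-s) := by
    refine Real.rpow_le_rpow_of_nonpos (by positivity) ?_ (by linarith)
    rw [mul_add, mul_inv_cancel_left₀ hR.ne']
    linarith
  rw [Real.div_rpow (by positivity) (by norm_num), Real.rpow_neg (by norm_num : (0 : ℝ) ≤ 5),
    div_inv_eq_mul, Real.mul_rpow hR.le (by positivity)] at h₁
  have h₂ : (1 + b) ^ (-γ) ≤ R ^ (-γ) * (R⁻¹ * b) ^ (-γ) := by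
    rw [← Real.mul_rpow hR.le (by positivity), mul_inv_cancel_left₀ hR.ne']
    exact Real.rpow_le_rpow_of_nonpos hb (by linarith) (by linarith)
  calc a ^ (-s) * (1 + b) ^ (-γ)
      ≤ (R ^ (-s) * (1 + R⁻¹ * b) ^ (-s) * 5 ^ s) * (R ^ (-γ) * (R⁻¹ * b) ^ (-γ)) := by gcongr
    _ = _ := by ring

end RieszPotential

/-- interior Riesz-potential estimate, regime `2 < γ < N`:
`∫_{ℝ^N} |x-y|^{-(N-2)} (1+|y|)^{-γ} dy ≤ C (1+|x|)^{2-γ}`. -/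
theorem stmt15 (N : ℕ) (hN : 3 ≤ N) (γ : ℝ) (hγ2 : 2 < γ) (hγN : γ < N) :
    ∃ C > 0, ∀ x : EuclideanSpace ℝ (Fin N),
      ∫ y : EuclideanSpace ℝ (Fin N),
          ‖x - y‖ ^ (-((N : ℝ) - 2)) * (1 + ‖y‖) ^ (-γ) ≤
        C * (1 + ‖x‖) ^ (2 - γ) := by
  have hN' : (3 : ℝ) ≤ N := by exact_mod_cast hN
  have : Nonempty (Fin N) := ⟨⟨0, by omega⟩⟩
  have hdim : Module.finrank ℝ (EuclideanSpace ℝ (Fin N)) = N := by simp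
  set s : ℝ := (N : ℝ) - 2 with hs
  let k : EuclideanSpace ℝ (Fin N) → ℝ := (Metric.ball 0 1).indicator fun z => ‖z‖ ^ (-s)
  let h : EuclideanSpace ℝ (Fin N) → ℝ := fun z => ‖z‖ ^ (-γ) * (1 + ‖z‖) ^ (-s)
  have hk : Integrable k := (integrable_indicator_iff measurableSet_ball).2
    (integrableOn_ball_norm_rpow_neg volume (by rw [hdim]; linarith))
  have hh : Integrable h := integrable_norm_rpow_neg_mul_one_add_norm_rpow_neg volume
    (by linarith) (by rw [hdim]; exact hγN) (by rw [hdim]; linarith)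
  have hk0 : ∀ z, 0 ≤ k z := fun z => Set.indicator_nonneg (fun _ _ => by positivity) z
  have hh0 : ∀ z, 0 ≤ h z := fun z => by positivity
  have hIk : 0 ≤ ∫ z, k z := integral_nonneg hk0
  have hIh : 0 ≤ ∫ z, h z := integral_nonneg hh0
  refine ⟨2 ^ γ * (∫ z, k z) + 5 ^ s * (∫ z, h z) + 1, by positivity, fun x => ?_⟩
  obtain ⟨R, hRx⟩ : ∃ R, R = 1 + ‖x‖ := ⟨_, rfl⟩
  have hR : 0 < R := by rw [hRx]; positivity
  rw [← hRx]
  have hkR : Integrable fun y => k (R⁻¹ • (x - y)) :=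
    (hk.comp_smul (inv_ne_zero hR.ne')).comp_sub_left x
  have hhR : Integrable fun y => h (R⁻¹ • y) := hh.comp_smul (inv_ne_zero hR.ne')
  have hnorm : ∀ z : EuclideanSpace ℝ (Fin N), ‖R⁻¹ • z‖ = R⁻¹ * ‖z‖ := fun z => by
    rw [norm_smul, Real.norm_of_nonneg (by positivity)]
  have hpt : ∀ y : EuclideanSpace ℝ (Fin N), y ≠ 0 →
      ‖x - y‖ ^ (-s) * (1 + ‖y‖) ^ (-γ) ≤
        R ^ (-s) * R ^ (-γ) * (2 ^ γ * k (R⁻¹ • (x - y)) + 5 ^ s * h (R⁻¹ • y)) := by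
    intro y hy
    have hxy : ‖x‖ ≤ ‖x - y‖ + ‖y‖ := by simpa using norm_add_le (x - y) y
    have hyx : ‖y‖ ≤ ‖x - y‖ + ‖x‖ := by
      rw [norm_sub_rev]; simpa using norm_add_le (y - x) x
    rcases lt_or_ge ‖x - y‖ (R / 2) with hlt | hge
    · have hmem : R⁻¹ • (x - y) ∈ Metric.ball (0 : EuclideanSpace ℝ (Fin N)) 1 := by
        rw [mem_ball_zero_iff, hnorm, inv_mul_lt_one₀ hR]
        linarith
      have hkeq : k (R⁻¹ • (x - y)) = (R⁻¹ * ‖x - y‖) ^ (-s) := by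
        simp only [k, Set.indicator_of_mem hmem, hnorm]
      refine (rpow_neg_mul_one_add_rpow_neg_le_of_lt (norm_nonneg _) hR (by linarith)
        (by linarith) hlt).trans ?_
      rw [← hkeq]
      gcongr
      exact le_add_of_nonneg_right (mul_nonneg (by positivity) (hh0 _))
    · refine (rpow_neg_mul_one_add_rpow_neg_le_of_le (norm_pos_iff.2 hy) hR (by linarith)
        (by linarith) (by linarith) hge).trans ?_
      rw [← hnorm]
      gcongr
      exact le_add_of_nonneg_left (mul_nonneg (by positivity) (hk0 _))
  have hae : ∀ᵐ y : EuclideanSpace ℝ (Fin N), y ≠ 0 := by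
    simp [ae_iff]
  have hpow : R ^ (-s) * R ^ (-γ) * R ^ N = R ^ (2 - γ) := by
    rw [← Real.rpow_natCast, ← Real.rpow_add hR, ← Real.rpow_add hR, hs]
    ring_nf
  calc ∫ y, ‖x - y‖ ^ (-s) * (1 + ‖y‖) ^ (-γ)
      ≤ ∫ y, R ^ (-s) * R ^ (-γ) * (2 ^ γ * k (R⁻¹ • (x - y)) + 5 ^ s * h (R⁻¹ • y)) :=
        integral_mono_of_nonneg (Filter.Eventually.of_forall fun y => by positivity)
          (((hkR.const_mul _).add (hhR.const_mul _)).const_mul _) (hae.mono hpt)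
    _ = R ^ (-s) * R ^ (-γ) * (2 ^ γ * (R ^ N * ∫ z, k z) + 5 ^ s * (R ^ N * ∫ z, h z)) := by
        rw [integral_const_mul, integral_add (hkR.const_mul _) (hhR.const_mul _),
          integral_const_mul, integral_const_mul,
          integral_sub_left_eq_self (fun z => k (R⁻¹ • z)) volume x,
          Measure.integral_comp_inv_smul_of_nonneg _ _ hR.le,
          Measure.integral_comp_inv_smul_of_nonneg _ _ hR.le, hdim, smul_eq_mul, smul_eq_mul]
    _ = (2 ^ γ * (∫ z, k z) + 5 ^ s * (∫ z, h z)) * R ^ (2 - γ) := by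
        rw [← hpow]; ring
    _ ≤ (2 ^ γ * (∫ z, k z) + 5 ^ s * (∫ z, h z) + 1) * R ^ (2 - γ) := by
        exact mul_le_mul_of_nonneg_right (le_add_of_nonneg_right zero_le_one) (by positivity)
end
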